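/- Let F : ℝ × ℝ → ℝ be a Borel measurable, locally bounded function satisfying both equation (A) and equation (B) with weight ω, define Ẑ(x,y) := 1 + ∫_y^x ω(z) F(z,y) dz, and let q ≥ 0 with W^{(q)} and Z^{(q)} as in the context. Then for all x ≥ y one has Ẑ(x,y) − Z^{(q)}(x−y) = ∫_y^x Ẑ(x,z) (ω(z) − q) W^{(q)}(z−y) dz. -/

import Mathlib

open MeasureTheory Set

noncomputable section

/-- A real-valued function is locally bounded if it is bounded on every compact set. -/
def LocBdd {α : Type*} [TopologicalSpace α] (f : α → ℝ) : Prop :=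
  ∀ K : Set α, IsCompact K → ∃ C : ℝ, ∀ x ∈ K, |f x| ≤ C

theorem LocBdd.comp {α β : Type*} [TopologicalSpace α] [TopologicalSpace β] {f : β → ℝ}
    (hf : LocBdd f) {φ : α → β} (hφ : Continuous φ) : LocBdd (fun x => f (φ x)) := fun K hK => by
  obtain ⟨C, hC⟩ := hf _ (hK.image hφ)
  exact ⟨C, fun x hx => hC _ (mem_image_of_mem φ hx)⟩

theorem LocBdd.mul {α : Type*} [TopologicalSpace α] {f g : α → ℝ}
    (hf : LocBdd f) (hg : LocBdd g) : LocBdd (fun x => f x * g x) := fun K hK => by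
  obtain ⟨C, hC⟩ := hf K hK
  obtain ⟨D, hD⟩ := hg K hK
  refine ⟨C * D, fun x hx => ?_⟩
  rw [abs_mul]
  exact mul_le_mul (hC x hx) (hD x hx) (abs_nonneg _) ((abs_nonneg _).trans (hC x hx))

theorem LocBdd.sub_const {α : Type*} [TopologicalSpace α] {f : α → ℝ}
    (hf : LocBdd f) (c : ℝ) : LocBdd (fun x => f x - c) := fun K hK => by
  obtain ⟨C, hC⟩ := hf K hK
  exact ⟨C + |c|, fun x hx => (abs_sub _ _).trans (by linarith [hC x hx])⟩

theorem LocBdd.intervalIntegrable {f : ℝ → ℝ} (hf : LocBdd f) (hm : Measurable f) (a b : ℝ) :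
    IntervalIntegrable f volume a b := by
  obtain ⟨C, hC⟩ := hf (uIcc a b) isCompact_uIcc
  rw [intervalIntegrable_iff]
  refine Measure.integrableOn_of_bounded (M := C) (by simp [uIoc])
    hm.aestronglyMeasurable ?_
  filter_upwards [ae_restrict_mem measurableSet_uIoc] with x hx
  exact hC x (uIoc_subset_uIcc hx)

/-- Fubini's theorem on the triangle `a ≤ z ≤ u ≤ b`. -/
theorem LocBdd.integral_triangle_swap {g : ℝ × ℝ → ℝ} (hg : LocBdd g) (hm : Measurable g)
    {a b : ℝ} (hab : a ≤ b) :
    IntervalIntegrable (fun z => ∫ u in z..b, g (u, z)) volume a b ∧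
      ∫ u in a..b, ∫ z in a..u, g (u, z) = ∫ z in a..b, ∫ u in z..b, g (u, z) := by
  have hT : MeasurableSet {p : ℝ × ℝ | p.2 < p.1} := measurableSet_lt measurable_snd measurable_fst
  have hint : Integrable ({p : ℝ × ℝ | p.2 < p.1}.indicator g)
      ((volume.restrict (Ioc a b)).prod (volume.restrict (Ioc a b))) := by
    refine Integrable.indicator ?_ hT
    obtain ⟨C, hC⟩ := hg (Icc a b ×ˢ Icc a b) (isCompact_Icc.prod isCompact_Icc)
    rw [Measure.prod_restrict]
    refine Measure.integrableOn_of_bounded (M := C) ?_ hm.aestronglyMeasurable ?_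
    · rw [Measure.prod_prod]
      exact ENNReal.mul_ne_top (by simp) (by simp)
    · filter_upwards [ae_restrict_mem (measurableSet_Ioc.prod measurableSet_Ioc)] with p hp
      exact hC p ⟨Ioc_subset_Icc_self hp.1, Ioc_subset_Icc_self hp.2⟩
  have hleft : ∀ u ∈ Ioc a b, ∫ z in Ioc a b, {p : ℝ × ℝ | p.2 < p.1}.indicator g (u, z)
      = ∫ z in a..u, g (u, z) := fun u hu => by
    have h : (fun z => {p : ℝ × ℝ | p.2 < p.1}.indicator g (u, z))
        = (Iio u).indicator fun z => g (u, z) := by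
      ext z; simp [indicator]
    rw [h, setIntegral_indicator measurableSet_Iio, intervalIntegral.integral_of_le hu.1.le,
      integral_Ioc_eq_integral_Ioo]
    congr 2
    ext z
    exact ⟨fun hz => ⟨hz.1.1, hz.2⟩, fun hz => ⟨⟨hz.1, hz.2.le.trans hu.2⟩, hz.2⟩⟩
  have hright : ∀ z ∈ Ioc a b, ∫ u in Ioc a b, {p : ℝ × ℝ | p.2 < p.1}.indicator g (u, z)
      = ∫ u in z..b, g (u, z) := fun z hz => by
    have h : (fun u => {p : ℝ × ℝ | p.2 < p.1}.indicator g (u, z))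
        = (Ioi z).indicator fun u => g (u, z) := by
      ext u; simp [indicator]
    rw [h, setIntegral_indicator measurableSet_Ioi, intervalIntegral.integral_of_le hz.2]
    congr 2
    ext u
    exact ⟨fun hu => ⟨hu.2, hu.1.2⟩, fun hu => ⟨⟨hz.1.trans hu.1, hu.2⟩, hu.1⟩⟩
  constructor
  · rw [intervalIntegrable_iff_integrableOn_Ioc_of_le hab]
    exact IntegrableOn.congr_fun hint.integral_prod_right hright measurableSet_Ioc
  · rw [intervalIntegral.integral_of_le hab, intervalIntegral.integral_of_le hab,
      ← setIntegral_congr_fun measurableSet_Ioc hleft,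
      ← setIntegral_congr_fun measurableSet_Ioc hright]
    exact integral_integral_swap (f := fun u z => {p : ℝ × ℝ | p.2 < p.1}.indicator g (u, z)) hint

/-- Resolvent identity: if `F = W + F ω W` and `V = W + q W V` as Volterra kernels, then
`F - V = F (ω - q) V`. -/
theorem kernel_sub_eq {W ω V : ℝ → ℝ} {F : ℝ × ℝ → ℝ} {q : ℝ}
    (hWm : Measurable W) (hW : LocBdd W) (hωm : Measurable ω) (hω : LocBdd ω)
    (hVm : Measurable V) (hV : LocBdd V) (hFm : Measurable F) (hF : LocBdd F)
    (hFW : ∀ x y : ℝ, F (x, y) = W (x - y) + ∫ z in y..x, F (x, z) * ω z * W (z - y))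
    (hVW : ∀ x : ℝ, V x = W x + q * ∫ z in (0 : ℝ)..x, W (x - z) * V z)
    {x y : ℝ} (hyx : y ≤ x) :
    F (x, y) - V (x - y) = ∫ z in y..x, F (x, z) * (ω z - q) * V (z - y) := by
  have hFx : LocBdd fun z => F (x, z) := hF.comp (by fun_prop)
  have hWx : LocBdd fun z => W (x - z) := hW.comp (by fun_prop)
  have hVy : LocBdd fun z => V (z - y) := hV.comp (by fun_prop)
  have hWy : LocBdd fun z => W (z - y) := hW.comp (by fun_prop)
  have hVW' : ∀ u, q * ∫ z in y..u, W (u - z) * V (z - y) = V (u - y) - W (u - y) := fun u => by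
    have h := intervalIntegral.integral_comp_sub_right (a := y) (b := u)
      (fun z => W (u - y - z) * V z) y
    simp only [sub_sub_sub_cancel_right, sub_self] at h
    rw [h, hVW (u - y)]
    ring
  have hswap := (LocBdd.integral_triangle_swap
    (g := fun p => F (x, p.1) * ω p.1 * (W (p.1 - p.2) * V (p.2 - y)))
    (((hF.comp (by fun_prop)).mul (hω.comp (by fun_prop))).mul
      ((hW.comp (by fun_prop)).mul (hV.comp (by fun_prop)))) (by fun_prop) hyx).2
  simp only [intervalIntegral.integral_const_mul] at hswap
  have hinner : ∀ z, ∫ u in z..x, F (x, u) * ω u * (W (u - z) * V (z - y))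
      = (F (x, z) - W (x - z)) * V (z - y) := fun z => by
    simp only [← mul_assoc, intervalIntegral.integral_mul_const]
    rw [hFW x z]
    ring
  simp only [hinner, sub_mul] at hswap
  have iFV := (hFx.mul hVy).intervalIntegrable (by fun_prop) y x
  have iWV := (hWx.mul hVy).intervalIntegrable (by fun_prop) y x
  have iFωV := ((hFx.mul hω).mul hVy).intervalIntegrable (by fun_prop) y x
  have iFωW := ((hFx.mul hω).mul hWy).intervalIntegrable (by fun_prop) y x
  rw [intervalIntegral.integral_sub iFV iWV] at hswap
  have hq := congrArg (q * ·) hswap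
  simp only [← intervalIntegral.integral_const_mul, mul_sub] at hq
  have hq' : ∫ u in y..x, q * (F (x, u) * ω u * ∫ z in y..u, W (u - z) * V (z - y))
      = (∫ u in y..x, F (x, u) * ω u * V (u - y)) - ∫ u in y..x, F (x, u) * ω u * W (u - y) := by
    rw [← intervalIntegral.integral_sub iFωV iFωW]
    refine intervalIntegral.integral_congr fun u _ => ?_
    rw [mul_left_comm, hVW']
    ring
  simp only [intervalIntegral.integral_const_mul] at hq hq'
  have hsplit : ∫ z in y..x, F (x, z) * (ω z - q) * V (z - y)
      = (∫ z in y..x, F (x, z) * ω z * V (z - y)) - q * ∫ z in y..x, F (x, z) * V (z - y) := by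
    rw [← intervalIntegral.integral_const_mul,
      ← intervalIntegral.integral_sub iFωV (iFV.const_mul q)]
    exact intervalIntegral.integral_congr fun z _ => by ring
  linarith [hFW x y, hVW' x]

/-- Identity (3.4) of the paper:
`Ẑ(x,y) - Z^{(q)}(x-y) = ∫_y^x Ẑ(x,z) (ω(z) - q) W^{(q)}(z-y) dz` for `x ≥ y`. -/
theorem statement6
    (W ω : ℝ → ℝ)
    (hWmeas : Measurable W) (hWbdd : LocBdd W) (hWneg : ∀ x : ℝ, x < 0 → W x = 0)
    (hωmeas : Measurable ω) (hωbdd : LocBdd ω) (hωpos : ∀ x : ℝ, 0 ≤ ω x)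
    (F : ℝ × ℝ → ℝ) (hFmeas : Measurable F) (hFbdd : LocBdd F)
    (hFA : ∀ x y : ℝ, F (x, y) = W (x - y) + ∫ z in y..x, W (x - z) * ω z * F (z, y))
    (hFB : ∀ x y : ℝ, F (x, y) = W (x - y) + ∫ z in y..x, F (x, z) * ω z * W (z - y))
    (Zh : ℝ → ℝ → ℝ)
    (hZh : ∀ x y : ℝ, Zh x y = 1 + ∫ z in y..x, ω z * F (z, y))
    (q : ℝ) (hq : 0 ≤ q)
    (Wq : ℝ → ℝ)
    (hWqmeas : Measurable Wq) (hWqbdd : LocBdd Wq) (hWqneg : ∀ x : ℝ, x < 0 → Wq x = 0)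
    (hWqeq : ∀ x : ℝ, Wq x = W x + q * ∫ z in (0 : ℝ)..x, W (x - z) * Wq z)
    (Zq : ℝ → ℝ)
    (hZq : ∀ x : ℝ, Zq x = 1 + q * ∫ z in (0 : ℝ)..x, Wq z) :
    ∀ x y : ℝ, y ≤ x →
      Zh x y - Zq (x - y) = ∫ z in y..x, Zh x z * (ω z - q) * Wq (z - y) := by
  intro x y hyx
  have hFy : LocBdd fun u => F (u, y) := hFbdd.comp (by fun_prop)
  have hWqy : LocBdd fun z => Wq (z - y) := hWqbdd.comp (by fun_prop)
  have iωF := (hωbdd.mul hFy).intervalIntegrable (by fun_prop) y x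
  have iωV := (hωbdd.mul hWqy).intervalIntegrable (by fun_prop) y x
  have iV := hWqy.intervalIntegrable (by fun_prop) y x
  have iωqV := ((hωbdd.sub_const q).mul hWqy).intervalIntegrable (by fun_prop) y x
  obtain ⟨hint, hswap⟩ := LocBdd.integral_triangle_swap
    (g := fun p => ω p.1 * F p * ((ω p.2 - q) * Wq (p.2 - y)))
    (((hωbdd.comp (by fun_prop)).mul hFbdd).mul
      (((hωbdd.sub_const q).comp (by fun_prop)).mul (hWqbdd.comp (by fun_prop))))
    (by fun_prop) hyx
  simp only [intervalIntegral.integral_mul_const] at hint hswap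
  have hleft : ∫ u in y..x, ∫ z in y..u, ω u * F (u, z) * ((ω z - q) * Wq (z - y))
      = (∫ u in y..x, ω u * F (u, y)) - ∫ u in y..x, ω u * Wq (u - y) := by
    rw [← intervalIntegral.integral_sub iωF iωV]
    refine intervalIntegral.integral_congr fun u hu => ?_
    rw [uIcc_of_le hyx] at hu
    rw [← mul_sub, kernel_sub_eq hWmeas hWbdd hωmeas hωbdd hWqmeas hWqbdd hFmeas hFbdd hFB hWqeq
      hu.1, ← intervalIntegral.integral_const_mul]
    exact intervalIntegral.integral_congr fun z _ => by ring
  have hright : ∫ z in y..x, Zh x z * (ω z - q) * Wq (z - y)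
      = (∫ z in y..x, (ω z - q) * Wq (z - y))
        + ∫ z in y..x, (∫ u in z..x, ω u * F (u, z)) * ((ω z - q) * Wq (z - y)) := by
    rw [← intervalIntegral.integral_add iωqV hint]
    refine intervalIntegral.integral_congr fun z _ => ?_
    simp only [hZh]
    ring
  have hsub : ∫ z in y..x, (ω z - q) * Wq (z - y)
      = (∫ z in y..x, ω z * Wq (z - y)) - q * ∫ z in y..x, Wq (z - y) := by
    rw [← intervalIntegral.integral_const_mul,
      ← intervalIntegral.integral_sub iωV (iV.const_mul q)]
    exact intervalIntegral.integral_congr fun z _ => by ring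
  have hshift : ∫ z in y..x, Wq (z - y) = ∫ z in (0 : ℝ)..(x - y), Wq z := by
    rw [intervalIntegral.integral_comp_sub_right, sub_self]
  rw [hright, ← hswap, hleft, hsub, hshift, hZh, hZq]
  ring
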